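/- arXiv:1604.06996 — 10 statements merged into one kernel-verified Lean document; each statement's English description precedes it below -/
import Mathlib

section
/- Let C ⊆ R^n be a code with coset decomposition C = ⋃_{j=1}^s (d_j + D_C), where D_C is a submodule of R^n and the cosets d_j + D_C are pairwise disjoint, and let h_1,…,h_m ∈ R^n generate D_C^⊥. Then the concatenated m×(n+s) matrix (H|S) with H_row(i) = h_i and entries s_{i,j} = h_i·d_j is a parity check system over R, i.e. it satisfies conditions (i), (ii), (iii) of the definition of a parity check system. -/
open scoped BigOperators

/-- Dot product on `Fin n → R`. -/
def dotP {R : Type*} [CommRing R] {n : ℕ} (x y : Fin n → R) : R := ∑ i, x i * y i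

/-- The orthogonal (dual) of a subset of `Fin n → R`, as a submodule. -/
def perp {R : Type*} [CommRing R] {n : ℕ} (B : Set (Fin n → R)) :
    Submodule R (Fin n → R) where
  carrier := {y | ∀ x ∈ B, dotP x y = 0}
  add_mem' := by
    intro y z hy hz x hx
    have h1 := hy x hx
    have h2 := hz x hx
    simp only [dotP, Set.mem_setOf_eq, Pi.add_apply, mul_add, Finset.sum_add_distrib] at *
    rw [h1, h2, add_zero]
  zero_mem' := by
    intro x hx
    simp [dotP]
  smul_mem' := by
    intro c y hy x hx
    have h1 := hy x hx
    simp only [dotP, Set.mem_setOf_eq] at *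
    have h2 : ∑ i, x i * (c • y) i = c * ∑ i, x i * y i := by
      rw [Finset.mul_sum]
      refine Finset.sum_congr rfl fun i _ => ?_
      simp only [Pi.smul_apply, smul_eq_mul]
      ring
    rw [h2, h1, mul_zero]

/-- The Frobenius property of a finite commutative ring: for every submodule `D` of `R^k`,
`D^⊥⊥ = D` and `|D| ⬝ |D^⊥| = |R|^k`. -/
def FrobeniusProperty (R : Type*) [CommRing R] : Prop :=
  ∀ (k : ℕ) (D : Submodule R (Fin k → R)),
    perp ((perp (D : Set (Fin k → R)) : Submodule R (Fin k → R)) : Set (Fin k → R)) = D ∧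
    Nat.card D * Nat.card (perp (D : Set (Fin k → R))) = Nat.card R ^ k

/-- `ε` is a generating additive character of `R`. -/
def IsGenChar (R : Type*) [CommRing R] (ε : R → ℂ) : Prop :=
  (∀ a b, ε (a + b) = ε a * ε b) ∧ ε 0 = 1 ∧ (∀ x, ε x ≠ 0) ∧
  ∀ χ : R → ℂ, (∀ a b, χ (a + b) = χ a * χ b) → (∀ x, χ x ≠ 0) →
    ∃ r : R, ∀ x, χ x = ε (r * x)

/-- A parity check system `(H|S)` over `R`. -/
def IsPCS {R : Type*} [CommRing R] {m n s : ℕ} (H : Matrix (Fin m) (Fin n) R)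
    (S : Matrix (Fin m) (Fin s) R) : Prop :=
  (∀ i j, ∃ x : Fin n → R, dotP (H i) x = S i j) ∧
  (∀ j j' : Fin s, (∀ i, S i j = S i j') → j = j') ∧
  (∀ r r' : Fin m → R, ∑ i, r i • H i = ∑ i, r' i • H i →
    ∑ i, r i • S i = ∑ i, r' i • S i)

/-- The code associated with a parity check system `(H|S)`. -/
def codeOf {R : Type*} [CommRing R] {m n s : ℕ} (H : Matrix (Fin m) (Fin n) R)
    (S : Matrix (Fin m) (Fin s) R) : Set (Fin n → R) :=
  {x | ∃ j : Fin s, H.mulVec x = fun i => S i j}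

/-- The minimum (Hamming) distance of a code. -/
noncomputable def minDist {R : Type*} [CommRing R] [DecidableEq R] {n : ℕ} (C : Set (Fin n → R)) : ℕ :=
  sInf {d | ∃ c ∈ C, ∃ c' ∈ C, c ≠ c' ∧ hammingDist c c' = d}

theorem dotP_comm {R : Type*} [CommRing R] {n : ℕ} (x y : Fin n → R) :
    dotP x y = dotP y x :=
  dotProduct_comm x y

theorem dotP_sub {R : Type*} [CommRing R] {n : ℕ} (x y z : Fin n → R) :
    dotP x (y - z) = dotP x y - dotP x z :=
  dotProduct_sub x y z

theorem sum_mul_dotP {R : Type*} [CommRing R] {m n : ℕ} (r : Fin m → R)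
    (h : Fin m → Fin n → R) (x : Fin n → R) :
    ∑ i, r i * dotP (h i) x = dotP (∑ i, r i • h i) x := by
  change ∑ i, r i * (h i ⬝ᵥ x) = (∑ i, r i • h i) ⬝ᵥ x
  simp only [sum_dotProduct, smul_dotProduct, smul_eq_mul]

/-- A vector orthogonal to a set is orthogonal to its span. -/
theorem mem_perp_span {R : Type*} [CommRing R] {n : ℕ} {B : Set (Fin n → R)} {v : Fin n → R}
    (hv : v ∈ perp B) : v ∈ perp (Submodule.span R B : Set (Fin n → R)) := by
  have hle : Submodule.span R B ≤ perp {v} := by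
    refine Submodule.span_le.2 fun x hx y hy => ?_
    rw [Set.mem_singleton_iff.1 hy, dotP_comm]
    exact hv x hx
  intro x hx
  rw [dotP_comm]
  exact hle hx v rfl

/-- given a code `C = ⋃ⱼ (dⱼ + D)` (pairwise disjoint cosets) and generators
`h₁,…,h_m` of `D^⊥`, the concatenated matrix with rows `hᵢ` and entries `sᵢⱼ = hᵢ·dⱼ`
is a parity check system over `R`. -/
theorem code_to_parity_check_system {R : Type*} [CommRing R] [Fintype R] [DecidableEq R]
    {n m s : ℕ} (hFrob : FrobeniusProperty R)
    (D : Submodule R (Fin n → R)) (d : Fin s → (Fin n → R))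
    (hdisj : ∀ j j' : Fin s, j ≠ j' →
      Disjoint ((fun t => d j + t) '' (D : Set (Fin n → R)))
        ((fun t => d j' + t) '' (D : Set (Fin n → R))))
    (h : Fin m → (Fin n → R))
    (hspan : Submodule.span R (Set.range h) = perp (D : Set (Fin n → R))) :
    IsPCS (Matrix.of h) (Matrix.of fun i j => dotP (h i) (d j)) := by
  refine ⟨fun i j => ⟨d j, rfl⟩, fun j j' hS => ?_, fun r r' hr => ?_⟩
  · by_contra hne
    have hperp : d j' - d j ∈ perp (Set.range h) := by
      rintro _ ⟨i, rfl⟩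
      rw [dotP_sub, sub_eq_zero]
      exact (hS i).symm
    have hD : d j' - d j ∈ D := by
      rw [← (hFrob n D).1, ← hspan]
      exact mem_perp_span hperp
    exact Set.disjoint_left.1 (hdisj j j' hne) ⟨d j' - d j, hD, add_sub_cancel _ _⟩
      ⟨0, D.zero_mem, add_zero _⟩
  · have hr' : ∑ i, r i • h i = ∑ i, r' i • h i := hr
    funext j
    simp only [Finset.sum_apply, Pi.smul_apply, smul_eq_mul, Matrix.of_apply]
    rw [sum_mul_dotP, sum_mul_dotP, hr']
end

section
/- Let (H|S) be a parity check system over R. Then every column of S is attained by H: for each j ∈ {1,…,s} there exists x ∈ R^n with Hx^T = S_col(j). -/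
open scoped BigOperators

/-- every column of `S` in a parity check system `(H|S)` is attained by `H`. -/
theorem pcs_columns_attained {R : Type*} [CommRing R] [Fintype R] [DecidableEq R]
    {m n s : ℕ} (hFrob : FrobeniusProperty R)
    (H : Matrix (Fin m) (Fin n) R) (S : Matrix (Fin m) (Fin s) R)
    (hPCS : IsPCS H S) :
    ∀ j : Fin s, ∃ x : Fin n → R, H.mulVec x = fun i => S i j := by
  intro j
  have hmem : (fun i => S i j) ∈ LinearMap.range H.mulVecLin := by
    rw [← (hFrob m (LinearMap.range H.mulVecLin)).1]
    intro r hr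
    have hrow : ∑ i, r i • H i = ∑ i, (0 : Fin m → R) i • H i := by
      ext k
      have h := hr (H.mulVec (Pi.single k 1)) ⟨Pi.single k 1, rfl⟩
      simpa [dotP, Matrix.col, mul_comm] using h
    have hS := congrFun (hPCS.2.2 r 0 hrow) j
    simpa [dotP] using hS
  exact hmem
end

section
/- Let (H|S) be a parity check system over R and let D = ⟨H_row(1),…,H_row(m)⟩^⊥. Then for each j ∈ {1,…,s} the solution set C_j = {x ∈ R^n : Hx^T = S_col(j)} is a coset of D (in particular nonempty), the sets C_1,…,C_s are pairwise disjoint, and consequently C = ⋃_{j=1}^s C_j is the unique code with a coset decomposition C = ⋃_{j=1}^s (d_j + D) into pairwise disjoint cosets of D whose representatives satisfy Hd_j^T = S_col(j). -/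
open scoped BigOperators

theorem mem_perp_iff {R : Type*} [CommRing R] {n : ℕ} {B : Set (Fin n → R)} {y : Fin n → R} :
    y ∈ perp B ↔ ∀ x ∈ B, dotProduct x y = 0 := Iff.rfl

/-- The dual of the row space of `H` is the kernel of `H`. -/
theorem mem_perp_span_rows_iff {R : Type*} [CommRing R] {m n : ℕ}
    (H : Matrix (Fin m) (Fin n) R) (x : Fin n → R) :
    x ∈ perp ((Submodule.span R (Set.range fun i => H i) :
      Submodule R (Fin n → R)) : Set (Fin n → R)) ↔ H.mulVec x = 0 := by
  rw [mem_perp_iff]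
  constructor
  · intro h
    funext i
    exact h (H i) (Submodule.subset_span ⟨i, rfl⟩)
  · intro h y hy
    induction hy using Submodule.span_induction with
    | mem y hy =>
      obtain ⟨i, rfl⟩ := hy
      exact congrFun h i
    | zero => exact zero_dotProduct x
    | add y z _ _ hy hz => rw [add_dotProduct, hy, hz, add_zero]
    | smul c y _ hy => rw [smul_dotProduct, hy, smul_zero]

/-- Over a ring with the Frobenius property, `H x = b` is solvable as soon as `b` is orthogonal
to every linear relation among the rows of `H`. -/
theorem exists_mulVec_eq_of_relations {R : Type*} [CommRing R] {m n : ℕ}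
    (hFrob : FrobeniusProperty R) (H : Matrix (Fin m) (Fin n) R) (b : Fin m → R)
    (hb : ∀ r : Fin m → R, Matrix.vecMul r H = 0 → dotProduct r b = 0) :
    ∃ x, H.mulVec x = b := by
  have key : b ∈ LinearMap.range H.mulVecLin := by
    rw [← (hFrob m (LinearMap.range H.mulVecLin)).1, mem_perp_iff]
    intro r hr
    refine hb r (dotProduct_eq_zero _ fun x => ?_)
    rw [← Matrix.dotProduct_mulVec, dotProduct_comm]
    exact mem_perp_iff.1 hr (H.mulVec x) ⟨x, rfl⟩
  exact key

/-- In a parity check system every column of `S` is a syndrome. -/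
theorem IsPCS.exists_mulVec_eq {R : Type*} [CommRing R] {m n s : ℕ}
    (hFrob : FrobeniusProperty R) {H : Matrix (Fin m) (Fin n) R} {S : Matrix (Fin m) (Fin s) R}
    (hPCS : IsPCS H S) (j : Fin s) : ∃ x, H.mulVec x = fun i => S i j := by
  refine exists_mulVec_eq_of_relations hFrob H _ fun r hr => ?_
  have h := hPCS.2.2 r 0 (by
    rw [← Matrix.vecMul_eq_sum, hr]
    simp)
  simpa [dotProduct] using congrFun h j

/-- The solution set of `H x = b` is the coset of the dual of the row space through any
solution. -/
theorem setOf_mulVec_eq_coset {R : Type*} [CommRing R] {m n : ℕ}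
    (H : Matrix (Fin m) (Fin n) R) {b : Fin m → R} {d : Fin n → R} (hd : H.mulVec d = b) :
    {x : Fin n → R | H.mulVec x = b} =
      (fun t => d + t) '' (perp ((Submodule.span R (Set.range fun i => H i) :
        Submodule R (Fin n → R)) : Set (Fin n → R)) : Set (Fin n → R)) := by
  ext x
  constructor
  · intro hx
    refine ⟨x - d, ?_, add_sub_cancel d x⟩
    rw [SetLike.mem_coe, mem_perp_span_rows_iff, Matrix.mulVec_sub, hd, sub_eq_zero]
    exact hx
  · rintro ⟨t, ht, rfl⟩
    rw [SetLike.mem_coe, mem_perp_span_rows_iff] at ht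
    rw [Set.mem_ofPred_eq, Matrix.mulVec_add, hd, ht, add_zero]

/-- for a parity check system `(H|S)` with `D = ⟨rows of H⟩^⊥`, each solution
set `Cⱼ = {x : Hxᵀ = S_col(j)}` is a coset of `D`, the `Cⱼ` are pairwise disjoint, and
`C = ⋃ⱼ Cⱼ` is the unique code having a coset decomposition into pairwise disjoint cosets
of `D` whose representatives satisfy `Hdⱼᵀ = S_col(j)`. -/
theorem parity_check_system_to_code {R : Type*} [CommRing R] [Fintype R] [DecidableEq R]
    {m n s : ℕ} (hFrob : FrobeniusProperty R)
    (H : Matrix (Fin m) (Fin n) R) (S : Matrix (Fin m) (Fin s) R)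
    (hPCS : IsPCS H S)
    (D : Submodule R (Fin n → R))
    (hD : D = perp ((Submodule.span R (Set.range fun i => H i) :
      Submodule R (Fin n → R)) : Set (Fin n → R))) :
    (∀ j : Fin s, ∃ dj : Fin n → R,
        {x : Fin n → R | H.mulVec x = fun i => S i j} =
          (fun t => dj + t) '' (D : Set (Fin n → R))) ∧
    (∀ j j' : Fin s, j ≠ j' →
        Disjoint {x : Fin n → R | H.mulVec x = fun i => S i j}
          {x : Fin n → R | H.mulVec x = fun i => S i j'}) ∧
    (∀ (C : Set (Fin n → R)) (d : Fin s → (Fin n → R)),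
        C = ⋃ j : Fin s, (fun t => d j + t) '' (D : Set (Fin n → R)) →
        (∀ j j' : Fin s, j ≠ j' →
          Disjoint ((fun t => d j + t) '' (D : Set (Fin n → R)))
            ((fun t => d j' + t) '' (D : Set (Fin n → R)))) →
        (∀ j : Fin s, H.mulVec (d j) = fun i => S i j) →
        C = ⋃ j : Fin s, {x : Fin n → R | H.mulVec x = fun i => S i j}) := by
  subst hD
  refine ⟨fun j => ?_, fun j j' hjj' => ?_, fun C d hC _ hd => ?_⟩
  · obtain ⟨d, hd⟩ := hPCS.exists_mulVec_eq hFrob j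
    exact ⟨d, setOf_mulVec_eq_coset H hd⟩
  · rw [Set.disjoint_left]
    intro x hx hx'
    exact hjj' (hPCS.2.1 j j' (congrFun (hx.symm.trans hx')))
  · rw [hC]
    exact Set.iUnion_congr fun j => (setOf_mulVec_eq_coset H (hd j)).symm
end

section
/- Let C = ⋃_{j=1}^s (d_j + D) be a code in R^n that is a union of pairwise disjoint cosets of a submodule D of R^n, let h_1,…,h_m ∈ R^n generate D^⊥, and let H be the m×n matrix with rows h_1,…,h_m and S the m×s matrix with entries s_{i,j} = h_i·d_j. Then for every x ∈ R^n, x ∈ C if and only if Hx^T ∈ {S_col(1),…,S_col(s)}. -/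
open scoped BigOperators

theorem subset_perp_comm {R : Type*} [CommRing R] {n : ℕ} {A B : Set (Fin n → R)} :
    A ⊆ perp B ↔ B ⊆ perp A := by
  have key : ∀ A B : Set (Fin n → R), A ⊆ perp B → B ⊆ perp A :=
    fun _ _ hAB b hb a ha => (dotP_comm a b).trans (hAB ha b hb)
  exact ⟨key A B, key B A⟩

theorem perp_span {R : Type*} [CommRing R] {n : ℕ} (B : Set (Fin n → R)) :
    perp (Submodule.span R B : Set (Fin n → R)) = perp B := by
  refine le_antisymm (fun y hy x hx => hy x (Submodule.subset_span hx)) ?_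
  have hB : B ⊆ perp (perp B : Set (Fin n → R)) := subset_perp_comm.mp subset_rfl
  exact subset_perp_comm.mp (Submodule.span_le.mpr hB)

/-- If `h` generates `D^⊥` and `D^⊥⊥ = D`, then `D` is the kernel of the parity checks `h`. -/
theorem mem_iff_forall_dotP_eq_zero {R : Type*} [CommRing R] {n : ℕ} {ι : Type*}
    {D : Submodule R (Fin n → R)} {h : ι → (Fin n → R)}
    (hD : perp (perp (D : Set (Fin n → R)) : Set (Fin n → R)) = D)
    (hspan : Submodule.span R (Set.range h) = perp (D : Set (Fin n → R)))
    (y : Fin n → R) : y ∈ D ↔ ∀ i, dotP (h i) y = 0 := by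
  rw [← hD, ← hspan, perp_span]
  exact Set.forall_mem_range

/-- for a code `C = ⋃ⱼ (dⱼ + D)` with `h₁,…,h_m` generating `D^⊥` and
`sᵢⱼ = hᵢ·dⱼ`, one has `x ∈ C` iff `Hxᵀ` is one of the columns of `S`. -/
theorem mem_code_iff_col {R : Type*} [CommRing R] [Fintype R] [DecidableEq R]
    {n m s : ℕ} (hFrob : FrobeniusProperty R)
    (C : Set (Fin n → R)) (D : Submodule R (Fin n → R)) (d : Fin s → (Fin n → R))
    (hC : C = ⋃ j : Fin s, (fun t => d j + t) '' (D : Set (Fin n → R)))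
    (hdisj : ∀ j j' : Fin s, j ≠ j' →
      Disjoint ((fun t => d j + t) '' (D : Set (Fin n → R)))
        ((fun t => d j' + t) '' (D : Set (Fin n → R))))
    (h : Fin m → (Fin n → R))
    (hspan : Submodule.span R (Set.range h) = perp (D : Set (Fin n → R))) :
    ∀ x : Fin n → R, x ∈ C ↔
      ∃ j : Fin s, (fun i => dotP (h i) x) = fun i => dotP (h i) (d j) := by
  intro x
  rw [hC, Set.mem_iUnion]
  refine exists_congr fun j => ?_
  have hcoset : x ∈ (fun t => d j + t) '' (D : Set (Fin n → R)) ↔ x - d j ∈ D := by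
    constructor
    · rintro ⟨t, ht, rfl⟩
      simpa using ht
    · exact fun hx => ⟨x - d j, hx, add_sub_cancel (d j) x⟩
  rw [hcoset, mem_iff_forall_dotP_eq_zero (hFrob n D).1 hspan, funext_iff]
  simp only [dotP_sub, sub_eq_zero]
end

section
/- Let (H|S) be a parity check system over R with associated code C, and define the kernel ker(C) = {x ∈ R^n : rx + C = C for all r ∈ R}. Then for every x ∈ R^n, x ∈ ker(C) if and only if for every r ∈ R the translated set {r·(Hx^T) + w : w ∈ col(S)} equals col(S), where col(S) = {S_col(1),…,S_col(s)} ⊆ R^m and addition and scalar multiplication of column vectors are componentwise. -/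
open scoped BigOperators

/-- Over a Frobenius ring, every column of `S` in a parity check system `(H|S)` is a syndrome. -/
theorem IsPCS.col_mem_range {R : Type*} [CommRing R] {m n s : ℕ} (hFrob : FrobeniusProperty R)
    {H : Matrix (Fin m) (Fin n) R} {S : Matrix (Fin m) (Fin s) R} (hPCS : IsPCS H S)
    (j : Fin s) : (fun i => S i j) ∈ LinearMap.range H.mulVecLin := by
  rw [← (hFrob m (LinearMap.range H.mulVecLin)).1]
  intro y hy
  have hH : ∑ i, y i • H i = ∑ i, (0 : Fin m → R) i • H i := by
    ext k
    have h := hy (H.mulVecLin (Pi.single k 1)) ⟨_, rfl⟩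
    simpa [dotP, mul_comm] using h
  have hS := congrFun (hPCS.2.2 y 0 hH) j
  simpa [dotP] using hS

/-- Translating the preimage of a set under `f` by `v` gives the preimage of the set translated
by `f v`. -/
theorem image_add_left_preimage {M N F : Type*} [AddGroup M] [AddGroup N] [FunLike F M N]
    [AddMonoidHomClass F M N] (f : F) (v : M) (T : Set N) :
    (fun c => v + c) '' (f ⁻¹' T) = f ⁻¹' ((fun w => f v + w) '' T) := by
  ext c
  simp [Set.image_add_left]

/-- for the code `C` associated with a parity check system `(H|S)`,
`x ∈ ker(C)` iff for every `r ∈ R` the set `r·(Hxᵀ) + col(S)` equals `col(S)`. -/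
theorem mem_kernel_iff {R : Type*} [CommRing R] [Fintype R] [DecidableEq R]
    {m n s : ℕ} (hFrob : FrobeniusProperty R)
    (H : Matrix (Fin m) (Fin n) R) (S : Matrix (Fin m) (Fin s) R)
    (hPCS : IsPCS H S) (x : Fin n → R) :
    (∀ r : R, (fun c => r • x + c) '' codeOf H S = codeOf H S) ↔
      (∀ r : R, (fun w => r • H.mulVec x + w) '' (Set.range fun j : Fin s => fun i => S i j) =
        Set.range fun j : Fin s => fun i => S i j) := by
  have hC : codeOf H S = H.mulVecLin ⁻¹' (Set.range fun j : Fin s => fun i => S i j) := by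
    ext y
    simp [codeOf, eq_comm]
  have hT : (Set.range fun j : Fin s => fun i => S i j) ⊆ Set.range H.mulVecLin := by
    rintro _ ⟨j, rfl⟩
    exact hPCS.col_mem_range hFrob j
  refine forall_congr' fun r => ?_
  have hv : H.mulVecLin (r • x) = r • H.mulVec x := by simp
  rw [hC, image_add_left_preimage, hv]
  refine Set.preimage_eq_preimage' ?_ hT
  rintro _ ⟨w, hw, rfl⟩
  obtain ⟨y, rfl⟩ := hT hw
  exact ⟨r • x + y, by rw [map_add, hv]⟩
end

section
/- Let (H|S) be a parity check system over R with associated code C. Then C is a submodule of R^n if and only if the set col(S) = {S_col(1),…,S_col(s)} ⊆ R^m is closed under componentwise addition and under componentwise scalar multiplication by every r ∈ R (equivalently, col(S) is a submodule of the R-module {Hz^T : z ∈ R^n}). -/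
open scoped BigOperators

/-- Over a ring with the Frobenius property, every column of `S` in a parity check system `(H|S)`
is a syndrome `H z`. -/
theorem IsPCS.exists_mulVec_eq_col {R : Type*} [CommRing R] {m n s : ℕ}
    (hFrob : FrobeniusProperty R) {H : Matrix (Fin m) (Fin n) R} {S : Matrix (Fin m) (Fin s) R}
    (hPCS : IsPCS H S) (j : Fin s) : ∃ z : Fin n → R, H.mulVec z = fun i => S i j := by
  suffices h : (fun i => S i j) ∈ LinearMap.range H.mulVecLin by
    simpa using h
  rw [← (hFrob m (LinearMap.range H.mulVecLin)).1]
  intro r hr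
  have hH : ∑ i, r i • H i = ∑ i, (0 : Fin m → R) i • H i := by
    ext k
    have h := hr (H.mulVec (Pi.single k 1)) ⟨Pi.single k 1, rfl⟩
    simpa [dotP, mul_comm] using h
  simpa [dotP] using congrFun (hPCS.2.2 r 0 hH) j

/-- the code `C` associated with a parity check system `(H|S)` is a submodule
of `R^n` iff `col(S)` is closed under componentwise addition and scalar multiplication. -/
theorem code_linear_iff {R : Type*} [CommRing R] [Fintype R] [DecidableEq R]
    {m n s : ℕ} (hFrob : FrobeniusProperty R)
    (H : Matrix (Fin m) (Fin n) R) (S : Matrix (Fin m) (Fin s) R)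
    (hPCS : IsPCS H S) (hs : 0 < s) :
    (∃ M : Submodule R (Fin n → R), (M : Set (Fin n → R)) = codeOf H S) ↔
      ((∀ u ∈ (Set.range fun j : Fin s => fun i => S i j),
          ∀ v ∈ (Set.range fun j : Fin s => fun i => S i j),
            u + v ∈ (Set.range fun j : Fin s => fun i => S i j)) ∧
        (∀ (r : R), ∀ u ∈ (Set.range fun j : Fin s => fun i => S i j),
            r • u ∈ (Set.range fun j : Fin s => fun i => S i j))) := by
  have hz := hPCS.exists_mulVec_eq_col hFrob
  constructor
  · rintro ⟨M, hM⟩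
    have mem : ∀ x, x ∈ M ↔ ∃ j, H.mulVec x = fun i => S i j := fun x => Set.ext_iff.mp hM x
    refine ⟨?_, ?_⟩
    · rintro _ ⟨j, rfl⟩ _ ⟨k, rfl⟩
      obtain ⟨x, hx⟩ := hz j
      obtain ⟨y, hy⟩ := hz k
      obtain ⟨l, hl⟩ := (mem _).1 (M.add_mem ((mem x).2 ⟨j, hx⟩) ((mem y).2 ⟨k, hy⟩))
      exact ⟨l, by rw [Matrix.mulVec_add, hx, hy] at hl; exact hl.symm⟩
    · rintro r _ ⟨j, rfl⟩
      obtain ⟨x, hx⟩ := hz j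
      obtain ⟨l, hl⟩ := (mem _).1 (M.smul_mem r ((mem x).2 ⟨j, hx⟩))
      exact ⟨l, by rw [Matrix.mulVec_smul, hx] at hl; exact hl.symm⟩
  · rintro ⟨hadd, hsmul⟩
    refine ⟨{ carrier := codeOf H S, add_mem' := ?_, zero_mem' := ?_, smul_mem' := ?_ }, rfl⟩
    · rintro x y ⟨j, hx⟩ ⟨k, hy⟩
      obtain ⟨l, hl⟩ := hadd _ ⟨j, rfl⟩ _ ⟨k, rfl⟩
      exact ⟨l, by rw [Matrix.mulVec_add, hx, hy]; exact hl.symm⟩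
    · obtain ⟨l, hl⟩ := hsmul 0 _ ⟨⟨0, hs⟩, rfl⟩
      exact ⟨l, by rw [Matrix.mulVec_zero]; simpa using hl.symm⟩
    · rintro r x ⟨j, hx⟩
      obtain ⟨l, hl⟩ := hsmul r _ ⟨j, rfl⟩
      exact ⟨l, by rw [Matrix.mulVec_smul, hx]; exact hl.symm⟩
end

section
/- Let (H|S) be a parity check system over R whose associated code C contains at least two elements, and let x ∈ R^n satisfy d_C(x) ≤ ⌊(d(C)−1)/2⌋, where d_C(x) = min{d(x,c) : c ∈ C}. Then there exist a unique l ∈ {1,…,s} and a unique y ∈ R^n with wt(y) = d_C(x) such that Hx^T = S_col(l) + Hy^T; moreover x − y ∈ C and d(x, x−y) = d_C(x), i.e. x − y is the unique nearest codeword to x in C. -/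
open scoped BigOperators

/-- Two distinct codewords are at distance at least the minimum distance. -/
theorem minDist_le_hammingDist {R : Type*} [CommRing R] [DecidableEq R] {n : ℕ}
    {C : Set (Fin n → R)} {c c' : Fin n → R} (hc : c ∈ C) (hc' : c' ∈ C) (hne : c ≠ c') :
    minDist C ≤ hammingDist c c' :=
  Nat.sInf_le ⟨c, hc, c', hc', hne, rfl⟩

/-- A code with at least two elements has positive minimum distance. -/
theorem minDist_pos {R : Type*} [CommRing R] [DecidableEq R] {n : ℕ}
    {C : Set (Fin n → R)} (h : ∃ c ∈ C, ∃ c' ∈ C, c ≠ c') : 0 < minDist C := by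
  obtain ⟨c, hc, c', hc', hne⟩ := h
  obtain ⟨a, -, b, -, hab, hd⟩ : minDist C ∈
      {d | ∃ c ∈ C, ∃ c' ∈ C, c ≠ c' ∧ hammingDist c c' = d} :=
    Nat.sInf_mem ⟨_, c, hc, c', hc', hne, rfl⟩
  exact hd ▸ hammingDist_pos.mpr hab

theorem hammingDist_self_sub {R : Type*} [CommRing R] [DecidableEq R] {n : ℕ}
    (x y : Fin n → R) : hammingDist x (x - y) = hammingNorm y := by
  rw [hammingDist_comm, hammingDist_eq_hammingNorm, neg_sub, sub_add_cancel]

/-- Codewords within half the minimum distance of a word are unique. -/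
theorem eq_of_hammingDist_le_half_minDist {R : Type*} [CommRing R] [DecidableEq R] {n : ℕ}
    {C : Set (Fin n → R)} (hC : 0 < minDist C) {x c c' : Fin n → R} (hc : c ∈ C) (hc' : c' ∈ C)
    (hxc : hammingDist x c ≤ (minDist C - 1) / 2)
    (hxc' : hammingDist x c' ≤ (minDist C - 1) / 2) : c = c' := by
  by_contra hne
  have hmin := minDist_le_hammingDist hc hc' hne
  have htri := hammingDist_triangle_left c c' x
  omega

/-- syndrome decoding with a parity check system. If
`d_C(x) ≤ ⌊(d(C)-1)/2⌋`, then there are `l` and `y` with `wt(y) = d_C(x)` and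
`Hxᵀ = S_col(l) + Hyᵀ`; moreover `x - y` is the nearest codeword to `x` in `C`, and
the pair `(l, y)` is unique. -/
theorem pcs_error_correction {R : Type*} [CommRing R] [Fintype R] [DecidableEq R]
    {m n s : ℕ} (hFrob : FrobeniusProperty R)
    (H : Matrix (Fin m) (Fin n) R) (S : Matrix (Fin m) (Fin s) R)
    (hPCS : IsPCS H S)
    (htwo : ∃ c ∈ codeOf H S, ∃ c' ∈ codeOf H S, c ≠ c')
    (x : Fin n → R) (dCx : ℕ)
    (hdCx : dCx = sInf {d : ℕ | ∃ c ∈ codeOf H S, hammingDist x c = d})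
    (hx : dCx ≤ (minDist (codeOf H S) - 1) / 2) :
    ∃ (l : Fin s) (y : Fin n → R),
      hammingNorm y = dCx ∧
      H.mulVec x = (fun i => S i l) + H.mulVec y ∧
      x - y ∈ codeOf H S ∧
      hammingDist x (x - y) = dCx ∧
      (∀ (l' : Fin s) (y' : Fin n → R), hammingNorm y' = dCx →
        H.mulVec x = (fun i => S i l') + H.mulVec y' → l' = l ∧ y' = y) := by
  obtain ⟨c, ⟨l, hl⟩, hd⟩ : dCx ∈ {d : ℕ | ∃ c ∈ codeOf H S, hammingDist x c = d} := by
    obtain ⟨c, hc, -⟩ := htwo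
    exact hdCx ▸ Nat.sInf_mem ⟨_, c, hc, rfl⟩
  have hcC : c ∈ codeOf H S := ⟨l, hl⟩
  have hxc : x - (x - c) = c := sub_sub_cancel x c
  refine ⟨l, x - c, ?_, ?_, ?_, ?_, ?_⟩
  · rw [← hammingDist_self_sub x, hxc, hd]
  · rw [← hl, ← Matrix.mulVec_add, add_sub_cancel]
  · rwa [hxc]
  · rw [hxc, hd]
  · intro l' y' hy' hH
    have hl' : H.mulVec (x - y') = fun i => S i l' := by
      rw [Matrix.mulVec_sub, hH, add_sub_cancel_right]
    have hc : x - y' = c :=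
      eq_of_hammingDist_le_half_minDist (minDist_pos htwo) ⟨l', hl'⟩ hcC
        (by rwa [hammingDist_self_sub x y', hy']) (by rwa [hd])
    refine ⟨hPCS.2.1 l' l fun i => ?_, by rw [← hc, sub_sub_cancel]⟩
    rw [hc, hl] at hl'
    exact (congrFun hl' i).symm
end

section
/- Let H be an m×n matrix over R with rows H_row(1),…,H_row(m), and let S_H be the set of column vectors v = (v_1,…,v_m)^T ∈ R^m such that (a) v_i ∈ {H_row(i)·x : x ∈ R^n} for every i, and (b) whenever Σ_{i=1}^m r_i H_row(i) = Σ_{i=1}^m r'_i H_row(i) for r_i, r'_i ∈ R, also Σ_{i=1}^m r_i v_i = Σ_{i=1}^m r'_i v_i. Then S_H = {Hx^T : x ∈ R^n}. -/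
open scoped BigOperators

/-- the set `S_H` of column vectors satisfying conditions (i) and (iii)
for `H` is exactly `{Hxᵀ : x ∈ Rⁿ}`. -/
theorem SH_eq_range_mulVec {R : Type*} [CommRing R] [Fintype R] [DecidableEq R]
    {m n : ℕ} (hFrob : FrobeniusProperty R)
    (H : Matrix (Fin m) (Fin n) R) :
    {v : Fin m → R |
        (∀ i, ∃ x : Fin n → R, dotP (H i) x = v i) ∧
        (∀ r r' : Fin m → R, ∑ i, r i • H i = ∑ i, r' i • H i →
          ∑ i, r i * v i = ∑ i, r' i * v i)} =
      {w : Fin m → R | ∃ x : Fin n → R, H.mulVec x = w} := by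
  have hS : ∀ r : Fin m → R, ∑ i, r i • H i = Matrix.vecMul r H := by
    intro r
    ext j
    simp [Matrix.vecMul, dotProduct, Finset.sum_apply]
  ext v
  simp only [Set.mem_ofPred_eq, hS]
  constructor
  · rintro ⟨-, hv⟩
    have hmem : v ∈ perp ((perp (LinearMap.range H.mulVecLin : Set (Fin m → R)) :
        Submodule R (Fin m → R)) : Set (Fin m → R)) := by
      intro r hr
      have hr0 : Matrix.vecMul r H = 0 := by
        ext j
        have h := hr (H.mulVec (Pi.single j 1)) ⟨Pi.single j 1, rfl⟩
        change H.mulVec (Pi.single j 1) ⬝ᵥ r = 0 at h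
        rw [dotProduct_comm, Matrix.dotProduct_mulVec] at h
        simpa using h
      simpa [dotP] using hv r 0 (by rw [hr0, Matrix.zero_vecMul])
    rw [(hFrob m (LinearMap.range H.mulVecLin)).1] at hmem
    exact hmem
  · rintro ⟨x, rfl⟩
    refine ⟨fun i => ⟨x, rfl⟩, fun r r' h => ?_⟩
    change r ⬝ᵥ H.mulVec x = r' ⬝ᵥ H.mulVec x
    rw [Matrix.dotProduct_mulVec, Matrix.dotProduct_mulVec, h]
end

section
/- Let (H|S) be a parity check system over R with associated code C and write ⟨H⟩ = ⟨H_row(1),…,H_row(m)⟩ for the submodule of R^n generated by the rows of H. If x ∉ ⟨H⟩ then δ̂_C(x) = 0, and if x = Σ_{i=1}^m r_i H_row(i) with r_i ∈ R, then δ̂_C(x) = (|R|^n / |⟨H⟩|) · Σ_{j=1}^s ε(−Σ_{i=1}^m r_i s_{i,j}) (the value Σ_{i=1}^m r_i s_{i,j} is independent of the chosen coefficients r_i by condition (iii)). -/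
open scoped BigOperators

/-- A generating character is trivial on no nonzero principal ideal. -/
theorem IsGenChar.eq_zero_of_forall_mul {R : Type*} [CommRing R] [Finite R] {ε : R → ℂ}
    (hε : IsGenChar R ε) {a : R} (h : ∀ t, ε (t * a) = 1) : a = 0 := by
  by_contra ha
  obtain ⟨ψ, hψ⟩ := AddChar.exists_apply_ne_zero.2 ha
  obtain ⟨u, hu⟩ := hε.2.2.2 ψ (fun a b => ψ.map_add_eq_mul a b) (fun x => (ψ.val_isUnit x).ne_zero)
  exact hψ ((hu a).trans (h u))

theorem dotP_add_right {R : Type*} [CommRing R] {n : ℕ} (x y z : Fin n → R) :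
    dotP x (y + z) = dotP x y + dotP x z := dotProduct_add x y z

theorem dotP_smul_right {R : Type*} [CommRing R] {n : ℕ} (t : R) (x y : Fin n → R) :
    dotP x (t • y) = t * dotP x y := dotProduct_smul t x y

theorem dotP_sum_smul_left {R : Type*} [CommRing R] {m n : ℕ} (H : Matrix (Fin m) (Fin n) R)
    (r : Fin m → R) (c : Fin n → R) :
    dotP (∑ i, r i • H i) c = ∑ i, r i * H.mulVec c i := by
  have h : ∑ i, r i • H i = Matrix.vecMul r H := by
    ext j
    simp [Matrix.vecMul, dotProduct]
  rw [h]
  exact (Matrix.dotProduct_mulVec r H c).symm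

theorem mem_perp_span_rows {R : Type*} [CommRing R] {m n : ℕ} {H : Matrix (Fin m) (Fin n) R}
    {y : Fin n → R} :
    y ∈ perp (Submodule.span R (Set.range fun i => H i) : Set (Fin n → R)) ↔
      H.mulVec y = 0 := by
  constructor
  · intro h
    ext i
    exact h _ (Submodule.subset_span ⟨i, rfl⟩)
  · intro h x hx
    obtain ⟨r, rfl⟩ := (Submodule.mem_span_range_iff_exists_fun R).1 hx
    rw [dotP_sum_smul_left, h]
    simp

/-- Over a ring with the Frobenius property, a vector lies in the image of `H` as soon as it
satisfies every linear relation between the rows of `H`. -/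
theorem FrobeniusProperty.exists_mulVec_eq {R : Type*} [CommRing R] (hR : FrobeniusProperty R)
    {m n : ℕ} {H : Matrix (Fin m) (Fin n) R} {v : Fin m → R}
    (hv : ∀ r : Fin m → R, ∑ i, r i • H i = 0 → ∑ i, r i * v i = 0) :
    ∃ d, H.mulVec d = v := by
  have key : v ∈ LinearMap.range H.mulVecLin := by
    rw [← (hR m (LinearMap.range H.mulVecLin)).1]
    intro r hr
    refine hv r ?_
    ext j
    have h := hr (H.mulVec (Pi.single j 1)) ⟨Pi.single j 1, rfl⟩
    simpa [dotP, mul_comm] using h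
  exact key

/-- Every nonempty fibre of `H` has the size of the kernel of `H`. -/
theorem card_filter_mulVec_eq {R : Type*} [CommRing R] [Fintype R] [DecidableEq R] {m n : ℕ}
    (H : Matrix (Fin m) (Fin n) R) (d : Fin n → R) :
    (Finset.univ.filter fun c => H.mulVec c = H.mulVec d).card =
      Nat.card (perp (Submodule.span R (Set.range fun i => H i) : Set (Fin n → R))) := by
  rw [← Fintype.card_subtype, ← Nat.card_eq_fintype_card]
  refine Nat.card_congr ((Equiv.subRight d).subtypeEquiv fun c => ?_)
  rw [mem_perp_span_rows, Equiv.subRight_apply, Matrix.mulVec_sub, sub_eq_zero]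

theorem finsum_mem_codeOf {R : Type*} [CommRing R] [Fintype R] [DecidableEq R] {m n s : ℕ}
    {H : Matrix (Fin m) (Fin n) R} {S : Matrix (Fin m) (Fin s) R} (hS : IsPCS H S)
    (f : (Fin n → R) → ℂ) :
    ∑ᶠ c ∈ codeOf H S, f c =
      ∑ j, ∑ c ∈ Finset.univ.filter (fun c => H.mulVec c = fun i => S i j), f c := by
  have hU : codeOf H S = ((Finset.univ.biUnion fun j : Fin s =>
      Finset.univ.filter (fun c => H.mulVec c = fun i => S i j) : Finset _) :
        Set (Fin n → R)) := by
    ext c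
    simp [codeOf]
  rw [hU, finsum_mem_coe_finset, Finset.sum_biUnion]
  intro j _ j' _ hne
  refine Finset.disjoint_left.2 fun c hc hc' => hne (hS.2.1 j j' fun i => ?_)
  simp only [Finset.mem_filter, Finset.mem_univ, true_and] at hc hc'
  exact congrFun (hc.symm.trans hc') i

/-- The Fourier coefficients of `C` vanish at `x` if some period `d` of `C` has
`ε (-(x ⬝ d)) ≠ 1`. -/
theorem finsum_mem_eq_zero_of_period {R : Type*} [CommRing R] {n : ℕ} {ε : R → ℂ}
    (hadd : ∀ a b, ε (a + b) = ε a * ε b) {C : Set (Fin n → R)} {x d : Fin n → R}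
    (hC : ∀ c, c + d ∈ C ↔ c ∈ C) (hd : ε (-(dotP x d)) ≠ 1) :
    ∑ᶠ c ∈ C, ε (-(dotP x c)) = 0 := by
  have h : ∑ᶠ c ∈ C, ε (-(dotP x c)) = ε (-(dotP x d)) * ∑ᶠ c ∈ C, ε (-(dotP x c)) := by
    rw [← smul_eq_mul, smul_finsum]
    conv_lhs => rw [← finsum_comp_equiv (Equiv.addRight d)]
    refine finsum_congr fun c => ?_
    rw [smul_finsum]
    refine finsum_congr_Prop (propext (hC c)) fun _ => ?_
    rw [Equiv.coe_addRight, dotP_add_right, neg_add_rev, hadd, smul_eq_mul]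
  by_contra h0
  exact hd (mul_right_cancel₀ h0 (by rw [one_mul, ← h]))

/-- Fourier coefficients of the code associated with a parity check system:
`δ̂_C(x) = 0` for `x ∉ ⟨H⟩` and
`δ̂_C(Σᵢ rᵢ H_row(i)) = (|R|ⁿ/|⟨H⟩|)·Σⱼ ε(-Σᵢ rᵢ sᵢⱼ)`. -/
theorem fourier_coeff_pcs {R : Type*} [CommRing R] [Fintype R] [DecidableEq R]
    {m n s : ℕ} (hFrob : FrobeniusProperty R)
    (ε : R → ℂ) (hε : IsGenChar R ε)
    (H : Matrix (Fin m) (Fin n) R) (S : Matrix (Fin m) (Fin s) R)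
    (hPCS : IsPCS H S) :
    (∀ x : Fin n → R, x ∉ Submodule.span R (Set.range fun i => H i) →
      ∑ᶠ c ∈ codeOf H S, ε (-(dotP x c)) = 0) ∧
    (∀ r : Fin m → R,
      ∑ᶠ c ∈ codeOf H S, ε (-(dotP (∑ i, r i • H i) c)) =
        ((Nat.card R : ℂ) ^ n /
            (Nat.card (Submodule.span R (Set.range fun i => H i)) : ℂ)) *
          ∑ j : Fin s, ε (-(∑ i, r i * S i j))) := by
  obtain ⟨hadd, -, -, -⟩ := id hε
  set D := Submodule.span R (Set.range fun i => H i) with hD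
  refine ⟨fun x hx => ?_, fun r => ?_⟩
  · obtain ⟨d, hd, hd1⟩ : ∃ d, H.mulVec d = 0 ∧ ε (-(dotP x d)) ≠ 1 := by
      by_contra! hcon
      refine hx ?_
      rw [← (hFrob n D).1]
      intro y hy
      rw [dotP_comm]
      refine hε.eq_zero_of_forall_mul fun t => ?_
      have h := hcon (-t • y) (by rw [Matrix.mulVec_smul, mem_perp_span_rows.1 hy, smul_zero])
      rwa [dotP_smul_right, neg_mul, neg_neg] at h
    refine finsum_mem_eq_zero_of_period hadd (fun c => ?_) hd1
    simp [codeOf, Matrix.mulVec_add, hd]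
  · have hcard : (Nat.card R : ℂ) ^ n / (Nat.card D : ℂ) =
        Nat.card (perp (D : Set (Fin n → R))) := by
      rw [div_eq_iff (Nat.cast_ne_zero.2 Nat.card_pos.ne'), mul_comm]
      exact_mod_cast (hFrob n D).2.symm
    rw [finsum_mem_codeOf hPCS, hcard, Finset.mul_sum]
    refine Finset.sum_congr rfl fun j _ => ?_
    obtain ⟨d, hd⟩ := hFrob.exists_mulVec_eq (H := H) (v := fun i => S i j) fun q hq => by
      simpa using congrFun (hPCS.2.2 q 0 (by simpa using hq)) j
    rw [hD, ← card_filter_mulVec_eq H d, hd, ← nsmul_eq_mul]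
    refine Finset.sum_eq_card_nsmul fun c hc => ?_
    rw [dotP_sum_smul_left, (Finset.mem_filter.1 hc).2]
end

section
/- Fix X, Y ∈ ℂ and define f : R^n × R^n → ℂ by f(z,z') = X^{n−d(z,z')} Y^{d(z,z')}. For h, h' ∈ R^n set f̂(h,h') = Σ_{(z,z')∈R^n×R^n} f(z,z') · ε(−(h·z)) · ε(−(h'·z')). Then f̂(h,h') = 0 whenever h' ≠ −h, and f̂(h,−h) = |R|^n · (X + (|R|−1)Y)^{n−wt(h)} · (X−Y)^{wt(h)}. -/
open scoped BigOperators

/-- A generating character, bundled as an `AddChar`. -/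
def IsGenChar.toAddChar {R : Type*} [CommRing R] {ε : R → ℂ} (hε : IsGenChar R ε) :
    AddChar R ℂ where
  toFun := ε
  map_zero_eq_one' := hε.2.1
  map_add_eq_mul' := hε.1

theorem IsGenChar.toAddChar_apply {R : Type*} [CommRing R] {ε : R → ℂ} (hε : IsGenChar R ε)
    (x : R) : hε.toAddChar x = ε x := rfl

/-- Over a finite ring, a generating character is primitive: `r ↦ ε (r * ·)` is a surjection from
`R` onto its character group, which has the same cardinality. -/
theorem IsGenChar.isPrimitive {R : Type*} [CommRing R] [Finite R] {ε : R → ℂ}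
    (hε : IsGenChar R ε) : hε.toAddChar.IsPrimitive := by
  have := Fintype.ofFinite R
  have hsurj : Function.Surjective hε.toAddChar.mulShift := by
    intro χ
    obtain ⟨r, hr⟩ := hε.2.2.2 χ χ.map_add_eq_mul fun x => (χ.val_isUnit x).ne_zero
    refine ⟨r, ?_⟩
    ext x
    rw [AddChar.mulShift_apply, hε.toAddChar_apply, hr]
  have hinj : Function.Injective hε.toAddChar.mulShift :=
    ((Fintype.bijective_iff_surjective_and_card _).2 ⟨hsurj, AddChar.card_eq.symm⟩).1
  intro r hr h1
  exact hr (hinj (h1.trans hε.toAddChar.mulShift_zero.symm))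

theorem IsGenChar.sum_neg_mul {R : Type*} [CommRing R] [Fintype R] [DecidableEq R] {ε : R → ℂ}
    (hε : IsGenChar R ε) (r : R) :
    ∑ x, ε (-(r * x)) = if r = 0 then (Fintype.card R : ℂ) else 0 := by
  have h := AddChar.sum_mulShift (-r) hε.isPrimitive
  simp only [hε.toAddChar_apply, neg_eq_zero] at h
  rw [Nat.cast_ite, Nat.cast_zero] at h
  rw [← h]
  exact Finset.sum_congr rfl fun x _ => by rw [mul_neg, mul_comm]

/-- The Fourier coefficients of the distance function in length one. -/
theorem IsGenChar.sum_sum_ite {R : Type*} [CommRing R] [Fintype R] [DecidableEq R] {ε : R → ℂ}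
    (hε : IsGenChar R ε) (X Y : ℂ) (r s : R) :
    ∑ a, ∑ b, (if a = b then X else Y) * ε (-(r * a)) * ε (-(s * b)) =
      (X - Y) * (if r + s = 0 then (Fintype.card R : ℂ) else 0) +
        Y * ((if r = 0 then (Fintype.card R : ℂ) else 0) *
          if s = 0 then (Fintype.card R : ℂ) else 0) := by
  rw [← hε.sum_neg_mul, ← hε.sum_neg_mul, ← hε.sum_neg_mul, Finset.sum_mul_sum, Finset.mul_sum,
    Finset.mul_sum, ← Finset.sum_add_distrib]
  refine Finset.sum_congr rfl fun a _ => ?_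
  have hsplit : ∀ b, (if a = b then X else Y) * ε (-(r * a)) * ε (-(s * b)) =
      (if a = b then (X - Y) * ε (-((r + s) * b)) else 0) +
        Y * (ε (-(r * a)) * ε (-(s * b))) := by
    intro b
    split_ifs with hab
    · rw [hab, add_mul, neg_add, hε.1]
      ring
    · ring
  simp only [hsplit, Finset.sum_add_distrib, Finset.sum_ite_eq, Finset.mem_univ, if_true,
    Finset.mul_sum]

theorem pow_sub_hammingNorm_mul_pow {ι M : Type*} {β : ι → Type*} [Fintype ι] [CommMonoid M]
    [∀ i, Zero (β i)] [∀ i, DecidableEq (β i)] (x y : M) (v : ∀ i, β i) :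
    x ^ (Fintype.card ι - hammingNorm v) * y ^ hammingNorm v =
      ∏ i, if v i = 0 then x else y := by
  have hcard : (Finset.univ.filter fun i => v i = 0).card + hammingNorm v = Fintype.card ι :=
    Finset.card_filter_add_card_filter_not _
  rw [Finset.prod_ite, Finset.prod_const, Finset.prod_const, ← hcard, Nat.add_sub_cancel]
  rfl

theorem IsGenChar.map_neg_dotP {R : Type*} [CommRing R] {n : ℕ} {ε : R → ℂ}
    (hε : IsGenChar R ε) (h z : Fin n → R) : ε (-(dotP h z)) = ∏ i, ε (-(h i * z i)) := by
  rw [dotP, ← Finset.sum_neg_distrib]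
  exact map_prod hε.toAddChar.toMonoidHom (fun i => Multiplicative.ofAdd (-(h i * z i))) Finset.univ

/-- The Fourier coefficients of the distance function factor over the coordinates. -/
theorem IsGenChar.sum_sum_distance {R : Type*} [CommRing R] [Fintype R] [DecidableEq R] {n : ℕ}
    {ε : R → ℂ} (hε : IsGenChar R ε) (X Y : ℂ) (h h' : Fin n → R) :
    ∑ z : Fin n → R, ∑ z' : Fin n → R,
        X ^ (n - hammingDist z z') * Y ^ hammingDist z z' *
          ε (-(dotP h z)) * ε (-(dotP h' z')) =
      ∏ i, ∑ a, ∑ b, (if a = b then X else Y) * ε (-(h i * a)) * ε (-(h' i * b)) := by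
  have hterm : ∀ z z' : Fin n → R, X ^ (n - hammingDist z z') * Y ^ hammingDist z z' *
      ε (-(dotP h z)) * ε (-(dotP h' z')) =
      ∏ i, (if z i = z' i then X else Y) * ε (-(h i * z i)) * ε (-(h' i * z' i)) := by
    intro z z'
    have hpow := pow_sub_hammingNorm_mul_pow X Y (-z + z')
    simp only [Fintype.card_fin, Pi.add_apply, Pi.neg_apply, neg_add_eq_zero] at hpow
    rw [hammingDist_eq_hammingNorm, hpow, hε.map_neg_dotP, hε.map_neg_dotP, Finset.prod_mul_distrib,
      Finset.prod_mul_distrib]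
  simp only [hterm, Fintype.prod_sum]

/-- the Fourier coefficients of `f(z,z') = X^{n-d(z,z')} Y^{d(z,z')}`:
`f̂(h,h') = 0` unless `h' = -h`, and
`f̂(h,-h) = |R|ⁿ (X + (|R|-1)Y)^{n-wt(h)} (X-Y)^{wt(h)}`. -/
theorem fourier_coeff_distance_function {R : Type*} [CommRing R] [Fintype R] [DecidableEq R]
    {n : ℕ} (ε : R → ℂ) (hε : IsGenChar R ε) (X Y : ℂ) (h h' : Fin n → R) :
    (h' ≠ -h →
      ∑ z : Fin n → R, ∑ z' : Fin n → R,
        X ^ (n - hammingDist z z') * Y ^ hammingDist z z' *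
          ε (-(dotP h z)) * ε (-(dotP h' z')) = 0) ∧
    (∑ z : Fin n → R, ∑ z' : Fin n → R,
        X ^ (n - hammingDist z z') * Y ^ hammingDist z z' *
          ε (-(dotP h z)) * ε (-(dotP (-h) z')) =
      (Nat.card R : ℂ) ^ n * (X + ((Nat.card R : ℂ) - 1) * Y) ^ (n - hammingNorm h) *
        (X - Y) ^ hammingNorm h) := by
  rw [hε.sum_sum_distance, hε.sum_sum_distance]
  simp only [hε.sum_sum_ite]
  constructor
  · intro hne
    obtain ⟨i, hi⟩ := Function.ne_iff.1 hne
    have hi' : h i + h' i ≠ 0 := fun h0 => hi (eq_neg_of_add_eq_zero_right h0)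
    refine Finset.prod_eq_zero (Finset.mem_univ i) ?_
    by_cases h0 : h i = 0
    · have hs : h' i ≠ 0 := by simpa [h0] using hi'
      simp [hi', hs]
    · simp [hi', h0]
  · have hpow := pow_sub_hammingNorm_mul_pow (X + ((Fintype.card R : ℂ) - 1) * Y) (X - Y) h
    rw [Fintype.card_fin] at hpow
    rw [Nat.card_eq_fintype_card, mul_assoc, hpow, ← Fin.prod_const, ← Finset.prod_mul_distrib]
    refine Finset.prod_congr rfl fun i _ => ?_
    by_cases h0 : h i = 0
    · simp only [Pi.neg_apply, h0, neg_zero, add_zero, if_true]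
      ring
    · simp only [Pi.neg_apply, h0, add_neg_cancel, if_true, if_false]
      ring
end
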